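/- Let (X,d,m) be a PI space and K ⊆ X a compact set. Fix f ∈ BV(X) with spt(f) ⊆ K. Then there exists a sequence (f_n) of simple BV functions, each supported in K, such that f_n → f in L¹(m) and |Df_n|(X) ≤ |Df|(X) for all n. -/

import Mathlib

open MeasureTheory Metric Filter Set
open scoped ENNReal NNReal Topology

namespace PaperBV

noncomputable section

variable {X : Type*} [MetricSpace X]

/-- `f` is locally Lipschitz on `Ω`. -/
def LocLipOn (Ω : Set X) (f : X → ℝ) : Prop :=
  ∀ x ∈ Ω, ∃ K : ℝ≥0, ∃ t ∈ 𝓝[Ω] x, LipschitzOnWith K f t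

/-- The local Lipschitz constant (slope) `lip f` of a function, with value `0` at
points that are not accumulation points (there the filter `𝓝[≠] x` is trivial). -/
def lipConst (f : X → ℝ) (x : X) : ℝ≥0∞ :=
  Filter.limsup (fun y => ENNReal.ofReal (|f y - f x| / dist y x)) (𝓝[≠] x)

variable [MeasurableSpace X]

/-- Convergence `fn → f` in `L¹_loc(μ⌊Ω)`. -/
def TendstoL1loc (μ : Measure X) (Ω : Set X) (fn : ℕ → X → ℝ) (f : X → ℝ) : Prop :=
  ∀ K : Set X, IsCompact K → K ⊆ Ω →
    Filter.Tendsto (fun n => ∫⁻ x in K, ENNReal.ofReal |fn n x - f x| ∂μ)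
      Filter.atTop (𝓝 0)

/-- The total variation `|Df|(Ω)` of `f` on an open set `Ω`, defined by relaxation of the
integral of the local Lipschitz constant along locally Lipschitz approximations. -/
def tvOpen (μ : Measure X) (f : X → ℝ) (Ω : Set X) : ℝ≥0∞ :=
  sInf { a : ℝ≥0∞ | ∃ fn : ℕ → X → ℝ, (∀ n, LocLipOn Ω (fn n)) ∧ TendstoL1loc μ Ω fn f ∧
    a = Filter.liminf (fun n => ∫⁻ x in Ω, lipConst (fn n) x ∂μ) Filter.atTop }

/-- The total variation measure `|Df|(B)` of `f` on an arbitrary set, obtained from the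
values on open sets by the Carathéodory construction. -/
def tv (μ : Measure X) (f : X → ℝ) (B : Set X) : ℝ≥0∞ :=
  ⨅ (Ω : Set X) (_ : IsOpen Ω) (_ : B ⊆ Ω), tvOpen μ f Ω

/-- `f` is a function of bounded variation: `f ∈ L¹(μ)` and `|Df|(X) < ∞`. -/
def BVFun (μ : Measure X) (f : X → ℝ) : Prop :=
  MeasureTheory.Integrable f μ ∧ tv μ f Set.univ < ⊤

/-- The perimeter `P(E, B) = |D 1_E|(B)`. -/
def perim (μ : Measure X) (E B : Set X) : ℝ≥0∞ :=
  tv μ (E.indicator fun _ => (1 : ℝ)) B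

/-- `E` is a (Borel) set of finite perimeter. -/
def FinPerim (μ : Measure X) (E : Set X) : Prop :=
  MeasurableSet E ∧ perim μ E Set.univ < ⊤

/-- `μ` is a doubling measure with doubling constant `CD`. -/
def Doubling (μ : Measure X) (CD : ℝ≥0) : Prop :=
  1 ≤ CD ∧ ∀ (x : X) (r : ℝ), 0 < r → μ (ball x (2 * r)) ≤ (CD : ℝ≥0∞) * μ (ball x r)

/-- The mean value `f_{x,r}` of `f` on the ball `B_r(x)`. -/
def ballAvg (μ : Measure X) (f : X → ℝ) (x : X) (r : ℝ) : ℝ :=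
  (∫ y in ball x r, f y ∂μ) / (μ (ball x r)).toReal

/-- The weak `(1,1)`-Poincaré inequality with constants `CP`, `lam`,
for locally Lipschitz functions. -/
def WeakPoincare (μ : Measure X) (CP lam : ℝ) : Prop :=
  ∀ f : X → ℝ, LocLipOn Set.univ f → ∀ (x : X) (r : ℝ), 0 < r →
    ∫⁻ y in ball x r, ENNReal.ofReal |f y - ballAvg μ f x r| ∂μ ≤
      ENNReal.ofReal (CP * r) * ∫⁻ y in ball x (lam * r), lipConst f y ∂μ

/-- A PI space: doubling and supporting a weak `(1,1)`-Poincaré inequality. -/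
def IsPI (μ : Measure X) : Prop :=
  ∃ (CD : ℝ≥0) (CP lam : ℝ), Doubling μ CD ∧ 0 < CP ∧ 1 ≤ lam ∧ WeakPoincare μ CP lam

/-- The pre-measure `H_δ` of the codimension-one Hausdorff measure: infimum over countable
covers by balls of radii at most `δ` of `∑ μ(B_{r_i}(x_i)) / (2 r_i)`. -/
def preH (μ : Measure X) (δ : ℝ) (S : Set X) : ℝ≥0∞ :=
  ⨅ (c : ℕ → X × ℝ) (_ : ∀ i, 0 < (c i).2 ∧ (c i).2 ≤ δ)
    (_ : S ⊆ ⋃ i, ball (c i).1 (c i).2),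
    ∑' i, μ (ball (c i).1 (c i).2) / ENNReal.ofReal (2 * (c i).2)

/-- The codimension-one Hausdorff measure `H = lim_{δ ↓ 0} H_δ = sup_{δ > 0} H_δ`
(as an outer-measure-type set function). -/
def codimH (μ : Measure X) (S : Set X) : ℝ≥0∞ :=
  ⨆ (δ : ℝ) (_ : 0 < δ), preH μ δ S

/-- The upper density of `E` at `x`. -/
def upperDens (μ : Measure X) (E : Set X) (x : X) : ℝ≥0∞ :=
  Filter.limsup (fun r : ℝ => μ (E ∩ ball x r) / μ (ball x r)) (𝓝[>] (0 : ℝ))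

/-- The essential boundary `∂^e E`. -/
def essBdry (μ : Measure X) (E : Set X) : Set X :=
  {x | 0 < upperDens μ E x ∧ 0 < upperDens μ Eᶜ x}

/-- The essential interior `E^1`: points of density `1`. -/
def essInt (μ : Measure X) (E : Set X) : Set X :=
  {x | Filter.Tendsto (fun r : ℝ => μ (E ∩ ball x r) / μ (ball x r))
    (𝓝[>] (0 : ℝ)) (𝓝 (1 : ℝ≥0∞))}

/-- Integral `∫_S f dν` with respect to an outer-measure-type set function `ν`,
via the layer-cake formula. -/
def outerLint (ν : Set X → ℝ≥0∞) (S : Set X) (f : X → ℝ≥0∞) : ℝ≥0∞ :=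
  ∫⁻ t in Set.Ioi (0 : ℝ), ν {x ∈ S | ENNReal.ofReal t < f x}

/-- `θ` is a family of densities representing the perimeter measures with respect to the
codimension-one Hausdorff measure: `P(E,B) = ∫_{B ∩ ∂^e E} θ_E dH`, with
`γ ≤ θ_E ≤ C` on `∂^e E` for structural constants `0 < γ`, `C < ∞`. -/
def PerimRepr (μ : Measure X) (θ : Set X → X → ℝ≥0∞) : Prop :=
  ∃ γ C : ℝ≥0∞, 0 < γ ∧ C ≠ ⊤ ∧
    ∀ E : Set X, FinPerim μ E →
      (∀ x ∈ essBdry μ E, γ ≤ θ E x ∧ θ E x ≤ C) ∧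
      ∀ B : Set X, MeasurableSet B →
        perim μ E B = outerLint (codimH μ) (B ∩ essBdry μ E) (θ E)

/-- The space is isotropic: the densities `θ_E` can be chosen so that, whenever `F ⊆ E` are
sets of finite perimeter, `θ_F = θ_E` holds `H`-a.e. on `∂^e F ∩ ∂^e E`. -/
def Isotropic (μ : Measure X) : Prop :=
  ∃ θ : Set X → X → ℝ≥0∞, PerimRepr μ θ ∧
    ∀ E F : Set X, FinPerim μ E → FinPerim μ F → F ⊆ E →
      codimH μ {x ∈ essBdry μ F ∩ essBdry μ E | θ F x ≠ θ E x} = 0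

/-- Property (1.2): `H(∂^e E ∩ ∂^e F ∩ ∂^e (E ∪ F)) = 0` for disjoint sets of finite
perimeter. -/
def Prop12 (μ : Measure X) : Prop :=
  ∀ E F : Set X, FinPerim μ E → FinPerim μ F → Disjoint E F →
    codimH μ (essBdry μ E ∩ essBdry μ F ∩ essBdry μ (E ∪ F)) = 0

/-- `E` is decomposable in `B`: `E ∩ B` admits a partition into two sets of finite perimeter
and positive measure such that the perimeter in `B` is additive. -/
def DecomposableIn (μ : Measure X) (E B : Set X) : Prop :=
  ∃ F G : Set X, FinPerim μ F ∧ FinPerim μ G ∧ Disjoint F G ∧ F ∪ G = E ∩ B ∧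
    0 < μ F ∧ 0 < μ G ∧ perim μ E B = perim μ F B + perim μ G B

/-- `E` is a set of finite perimeter which is indecomposable in `B`. -/
def IndecomposableIn (μ : Measure X) (E B : Set X) : Prop :=
  FinPerim μ E ∧ ¬ DecomposableIn μ E B

/-- `E` is an indecomposable set (of finite perimeter). -/
def Indecomposable (μ : Measure X) (E : Set X) : Prop :=
  IndecomposableIn μ E Set.univ

/-- `E` is a simple set. -/
def SimpleSet (μ : Measure X) (E : Set X) : Prop :=
  FinPerim μ E ∧ μ E < ⊤ ∧
  ∀ F : Set X, FinPerim μ F → codimH μ (essBdry μ F \ essBdry μ E) = 0 →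
    μ F = 0 ∨ μ Fᶜ = 0 ∨ μ (symmDiff F E) = 0 ∨ μ (symmDiff F Eᶜ) = 0

end

variable {X : Type*} [MetricSpace X] [CompleteSpace X] [TopologicalSpace.SeparableSpace X]
  [MeasurableSpace X] [BorelSpace X]

/-- A simple BV function: a finite linear combination of indicator functions of sets of
finite perimeter and finite measure. -/
def SimpleBVFun (μ : Measure X) (g : X → ℝ) : Prop :=
  ∃ (n : ℕ) (lam : Fin n → ℝ) (E : Fin n → Set X),
    (∀ i, FinPerim μ (E i) ∧ μ (E i) < ⊤) ∧
    g = fun x => ∑ i, lam i * (E i).indicator (fun _ => (1 : ℝ)) x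

section PropernessAndSlope

variable {Y : Type*} [MetricSpace Y]

theorem LocLipOn.continuous {f : Y → ℝ} (hf : LocLipOn univ f) : Continuous f := by
  rw [continuous_iff_continuousAt]
  intro x
  obtain ⟨K, t, ht, hL⟩ := hf x (mem_univ x)
  rw [nhdsWithin_univ] at ht
  exact hL.continuousOn.continuousAt ht

theorem LocLipOn.comp_lipschitz {Ω : Set Y} {f : Y → ℝ} (hf : LocLipOn Ω f) {φ : ℝ → ℝ} {C : ℝ≥0}
    (hφ : LipschitzWith C φ) : LocLipOn Ω (fun x => φ (f x)) := by
  intro x hx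
  obtain ⟨K, t, ht, hL⟩ := hf x hx
  exact ⟨C * K, t, ht, hφ.comp_lipschitzOnWith hL⟩

theorem LocLipOn.add {Ω : Set Y} {f g : Y → ℝ} (hf : LocLipOn Ω f) (hg : LocLipOn Ω g) :
    LocLipOn Ω (fun x => f x + g x) := by
  intro x hx
  obtain ⟨K, t, ht, hL⟩ := hf x hx
  obtain ⟨K', t', ht', hL'⟩ := hg x hx
  exact ⟨K + K', t ∩ t', inter_mem ht ht',
    (hL.mono inter_subset_left).add (hL'.mono inter_subset_right)⟩

theorem limsup_add_le_add {α : Type*} {l : Filter α} (u v : α → ℝ≥0∞) :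
    limsup (fun a => u a + v a) l ≤ limsup u l + limsup v l := by
  rcases eq_or_ne (limsup u l) ⊤ with hu | hu
  · simp [hu]
  rcases eq_or_ne (limsup v l) ⊤ with hv | hv
  · simp [hv]
  refine ENNReal.le_of_forall_pos_le_add fun ε hε _ => ?_
  have hε' : (ε / 2 : ℝ≥0∞) ≠ 0 := by simp [hε.ne']
  have h1 := eventually_lt_of_limsup_lt (ENNReal.lt_add_right hu hε')
  have h2 := eventually_lt_of_limsup_lt (ENNReal.lt_add_right hv hε')
  refine limsup_le_of_le (by isBoundedDefault) ?_
  filter_upwards [h1, h2] with a ha hb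
  calc u a + v a ≤ (limsup u l + ε / 2) + (limsup v l + ε / 2) := add_le_add ha.le hb.le
    _ = limsup u l + limsup v l + (ε / 2 + ε / 2) := by ring
    _ = _ := by rw [ENNReal.add_halves]

theorem lipConst_add_le (f g : Y → ℝ) (x : Y) :
    lipConst (fun y => f y + g y) x ≤ lipConst f x + lipConst g x := by
  refine le_trans (limsup_le_limsup (Eventually.of_forall fun y => ?_)) (limsup_add_le_add _ _)
  rw [← ENNReal.ofReal_add (by positivity) (by positivity), ← add_div]
  refine ENNReal.ofReal_le_ofReal (div_le_div_of_nonneg_right ?_ dist_nonneg)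
  calc |f y + g y - (f x + g x)| = |(f y - f x) + (g y - g x)| := by ring_nf
    _ ≤ _ := abs_add_le _ _

theorem lipConst_comp_le (f : Y → ℝ) {φ : ℝ → ℝ} {C : ℝ≥0} (hφ : LipschitzWith C φ) (x : Y) :
    lipConst (fun y => φ (f y)) x ≤ C * lipConst f x := by
  rw [lipConst, lipConst, ← ENNReal.limsup_const_mul_of_ne_top ENNReal.coe_ne_top]
  refine limsup_le_limsup (Eventually.of_forall fun y => ?_)
  beta_reduce
  rw [← ENNReal.ofReal_coe_nnreal, ← ENNReal.ofReal_mul C.coe_nonneg, ← mul_div_assoc]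
  refine ENNReal.ofReal_le_ofReal (div_le_div_of_nonneg_right ?_ dist_nonneg)
  simpa [Real.dist_eq] using hφ.dist_le_mul (f y) (f x)

theorem lipConst_eq_zero_of_eventuallyEq {f : Y → ℝ} {x : Y} (h : ∀ᶠ y in 𝓝 x, f y = f x) :
    lipConst f x = 0 := by
  refine le_antisymm ?_ bot_le
  refine limsup_le_of_le (by isBoundedDefault) ?_
  filter_upwards [mem_nhdsWithin_of_mem_nhds h] with y hy
  simp [hy]

theorem measurable_lipConst [MeasurableSpace Y] [BorelSpace Y] {f : Y → ℝ} (hf : Continuous f) :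
    Measurable (lipConst f) := by
  have hbasis (x : Y) : (𝓝[≠] x).HasBasis (fun _ : ℕ => True)
      fun n => ball x (1 / (n + 1 : ℝ)) ∩ {x}ᶜ :=
    nhds_basis_ball_inv_nat_succ.inf_principal _
  have key : lipConst f = fun x => ⨅ n : ℕ, ⨆ y ∈ ball x (1 / (n + 1 : ℝ)) ∩ {x}ᶜ,
      ENNReal.ofReal (|f y - f x| / dist y x) := by
    ext x
    simpa [lipConst] using (hbasis x).limsup_eq_iInf_iSup
      (u := fun y => ENNReal.ofReal (|f y - f x| / dist y x))
  rw [key]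
  refine Measurable.iInf fun n => LowerSemicontinuous.measurable ?_
  intro x a ha
  simp only [lt_iSup_iff] at ha
  obtain ⟨y, ⟨hy, hne⟩, hay⟩ := ha
  have hne' : dist y x ≠ 0 := dist_ne_zero.2 hne
  have hc : ContinuousAt (fun z => ENNReal.ofReal (|f y - f z| / dist y z)) x := by
    refine ENNReal.continuous_ofReal.continuousAt.comp (ContinuousAt.div ?_ ?_ hne')
    · fun_prop
    · fun_prop
  have h1 : ∀ᶠ z in 𝓝 x, dist y z < 1 / (n + 1 : ℝ) :=
    (continuous_const.dist continuous_id).continuousAt.eventually_lt continuousAt_const hy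
  have h2 : ∀ᶠ z in 𝓝 x, dist y z ≠ 0 :=
    (continuous_const.dist continuous_id).continuousAt.eventually_ne hne'
  filter_upwards [h1, h2, hc.eventually (lt_mem_nhds hay)] with z hz1 hz2 hz3
  refine hz3.trans_le ?_
  exact le_iSup₂_of_le y ⟨hz1, dist_ne_zero.1 hz2⟩ le_rfl

theorem Doubling.measure_ball_pow_le [MeasurableSpace Y] {μ : Measure Y} {C : ℝ≥0}
    (h : Doubling μ C) (x : Y) {r : ℝ} (hr : 0 < r) (n : ℕ) :
    μ (ball x (2 ^ n * r)) ≤ (C : ℝ≥0∞) ^ n * μ (ball x r) := by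
  induction n with
  | zero => simp
  | succ n ih =>
    calc μ (ball x (2 ^ (n + 1) * r)) = μ (ball x (2 * (2 ^ n * r))) := by ring_nf
      _ ≤ C * μ (ball x (2 ^ n * r)) := h.2 x _ (by positivity)
      _ ≤ C * ((C : ℝ≥0∞) ^ n * μ (ball x r)) := by gcongr
      _ = _ := by ring

theorem exists_le_two_pow_mul (R : ℝ) {r : ℝ} (hr : 0 < r) : ∃ n : ℕ, R ≤ 2 ^ n * r := by
  obtain ⟨n, hn⟩ := pow_unbounded_of_one_lt (R / r) (one_lt_two)
  exact ⟨n, by rw [div_lt_iff₀ hr] at hn; exact hn.le⟩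

theorem Doubling.measure_ball_lt_top [MeasurableSpace Y] {μ : Measure Y}
    [IsLocallyFiniteMeasure μ] {C : ℝ≥0} (h : Doubling μ C) (x : Y) (R : ℝ) :
    μ (ball x R) < ⊤ := by
  obtain ⟨s, hs, hμs⟩ := μ.finiteAt_nhds x
  obtain ⟨r, hr, hrs⟩ := Metric.mem_nhds_iff.1 hs
  obtain ⟨n, hn⟩ := exists_le_two_pow_mul R hr
  calc μ (ball x R) ≤ μ (ball x (2 ^ n * r)) := measure_mono (ball_subset_ball hn)
    _ ≤ (C : ℝ≥0∞) ^ n * μ (ball x r) := h.measure_ball_pow_le x hr n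
    _ < ⊤ := ENNReal.mul_lt_top (ENNReal.pow_lt_top ENNReal.coe_lt_top)
      ((measure_mono hrs).trans_lt hμs)

theorem Doubling.measure_ball_ne_zero [MeasurableSpace Y] {μ : Measure Y} (hμ : μ ≠ 0)
    {C : ℝ≥0} (h : Doubling μ C) (x : Y) {r : ℝ} (hr : 0 < r) : μ (ball x r) ≠ 0 := by
  intro h0
  apply hμ
  rw [← Measure.measure_univ_eq_zero, ← iUnion_ball_nat x, measure_iUnion_null_iff]
  intro k
  obtain ⟨n, hn⟩ := exists_le_two_pow_mul (k : ℝ) hr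
  refine measure_mono_null (ball_subset_ball hn) (le_antisymm ?_ bot_le)
  simpa [h0] using h.measure_ball_pow_le x hr n

theorem Doubling.properSpace [CompleteSpace Y] [MeasurableSpace Y] [BorelSpace Y]
    {μ : Measure Y} [IsLocallyFiniteMeasure μ] (hμ : μ ≠ 0) {C : ℝ≥0} (h : Doubling μ C) :
    ProperSpace Y := by
  refine ProperSpace.of_isCompact_closedBall_of_le 0 fun x R _ => ?_
  refine isCompact_iff_totallyBounded_isComplete.2 ⟨?_, isClosed_closedBall.isComplete⟩
  rw [Metric.totallyBounded_iff]
  intro ε hε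
  by_contra! hcon
  obtain ⟨p, hp, hsep⟩ := exists_seq_of_forall_finset_exists (fun y => y ∈ closedBall x R)
    (fun y z => ε ≤ dist y z) (by
      intro s _
      obtain ⟨y, hy, hys⟩ := not_subset.1 (hcon s s.finite_toSet)
      refine ⟨y, hy, fun z hz => ?_⟩
      by_contra! hlt
      exact hys (mem_biUnion (Finset.mem_coe.2 hz) (by rwa [mem_ball, dist_comm])))
  have hdisj : Pairwise (Function.onFun Disjoint fun n => ball (p n) (ε / 2)) := by
    intro m n hmn
    refine ball_disjoint_ball ?_
    rw [add_halves]
    rcases lt_or_gt_of_ne hmn with hlt | hlt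
    · exact hsep m n hlt
    · rw [dist_comm]
      exact hsep n m hlt
  have hsub : ⋃ n, ball (p n) (ε / 2) ⊆ ball x (R + ε) := by
    refine iUnion_subset fun n => ball_subset_ball' ?_
    have := mem_closedBall.1 (hp n)
    linarith
  obtain ⟨k, hk⟩ := exists_le_two_pow_mul (R + R + ε) (half_pos hε)
  have hlow (n : ℕ) : μ (ball x (R + ε)) / (C : ℝ≥0∞) ^ k ≤ μ (ball (p n) (ε / 2)) := by
    refine ENNReal.div_le_of_le_mul' ?_
    refine le_trans (measure_mono (ball_subset_ball' ?_))
      (h.measure_ball_pow_le (p n) (half_pos hε) k)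
    have := mem_closedBall'.1 (hp n)
    linarith
  have hR : 0 < R + ε := by
    have := dist_nonneg.trans (mem_closedBall.1 (hp 0))
    linarith
  have hsum : ∑' _ : ℕ, μ (ball x (R + ε)) / (C : ℝ≥0∞) ^ k ≤ μ (ball x (R + ε)) :=
    calc _ ≤ ∑' n, μ (ball (p n) (ε / 2)) := ENNReal.tsum_le_tsum hlow
      _ ≤ μ (⋃ n, ball (p n) (ε / 2)) :=
        tsum_meas_le_meas_iUnion_of_disjoint μ (fun _ => measurableSet_ball) hdisj
      _ ≤ _ := measure_mono hsub
  rw [ENNReal.tsum_const_eq_top_of_ne_zero, top_le_iff] at hsum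
  · exact (h.measure_ball_lt_top x _).ne hsum
  · exact ENNReal.div_ne_zero.2
      ⟨h.measure_ball_ne_zero hμ x hR, ENNReal.pow_ne_top ENNReal.coe_ne_top⟩

end PropernessAndSlope
section TotalVariation

variable {Y : Type*} [MetricSpace Y] [MeasurableSpace Y]

theorem tv_univ (μ : Measure Y) (f : Y → ℝ) : tv μ f univ = tvOpen μ f univ := by
  refine le_antisymm (iInf_le_of_le univ (iInf₂_le isOpen_univ subset_rfl)) ?_
  refine le_iInf fun Ω => le_iInf₂ fun _ h => ?_
  rw [univ_subset_iff.1 h]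

theorem tv_univ_le_liminf {μ : Measure Y} {f : Y → ℝ} {u : ℕ → Y → ℝ}
    (hu : ∀ n, LocLipOn univ (u n)) (hlim : TendstoL1loc μ univ u f) :
    tv μ f univ ≤ liminf (fun n => ∫⁻ x, lipConst (u n) x ∂μ) atTop := by
  rw [tv_univ]
  exact sInf_le ⟨u, hu, hlim, by simp⟩

theorem tv_univ_le {μ : Measure Y} {f : Y → ℝ} {u : ℕ → Y → ℝ} {a : ℝ≥0∞}
    (hu : ∀ n, LocLipOn univ (u n)) (hlim : TendstoL1loc μ univ u f)
    (ha : ∀ n, ∫⁻ x, lipConst (u n) x ∂μ ≤ a) : tv μ f univ ≤ a :=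
  (tv_univ_le_liminf hu hlim).trans (liminf_le_of_le (by isBoundedDefault) fun _ hb =>
    let ⟨n, hn⟩ := hb.exists
    hn.trans (ha n))

theorem exists_seq_of_tv_univ_lt {μ : Measure Y} {f : Y → ℝ} {a : ℝ≥0∞}
    (h : tv μ f univ < a) :
    ∃ u : ℕ → Y → ℝ, (∀ n, LocLipOn univ (u n)) ∧ TendstoL1loc μ univ u f ∧
      ∀ n, ∫⁻ x, lipConst (u n) x ∂μ < a := by
  rw [tv_univ] at h
  obtain ⟨b, ⟨u, hu, hlim, rfl⟩, hb⟩ := sInf_lt_iff.1 h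
  obtain ⟨φ, hφ, hlt⟩ := extraction_of_frequently_atTop
    (frequently_lt_of_liminf_lt (by isBoundedDefault) hb)
  exact ⟨fun n => u (φ n), fun n => hu _,
    fun K hK hKu => (hlim K hK hKu).comp hφ.tendsto_atTop, by simpa using hlt⟩

theorem tv_univ_congr_ae {μ : Measure Y} {f g : Y → ℝ} (h : f =ᵐ[μ] g) :
    tv μ f univ = tv μ g univ := by
  have key (u : ℕ → Y → ℝ) : TendstoL1loc μ univ u f ↔ TendstoL1loc μ univ u g := by
    refine forall₃_congr fun K _ _ => ?_
    have (n : ℕ) : ∫⁻ x in K, ENNReal.ofReal |u n x - f x| ∂μ =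
        ∫⁻ x in K, ENNReal.ofReal |u n x - g x| ∂μ :=
      lintegral_congr_ae ((ae_restrict_of_ae h).mono fun x hx => by simp only [hx])
    simp only [this]
  simp only [tv_univ, tvOpen, key]

theorem tv_univ_const (μ : Measure Y) (c : ℝ) : tv μ (fun _ => c) univ = 0 := by
  refine le_antisymm (tv_univ_le (u := fun _ _ => c) (fun _ x _ => ?_) (fun K _ _ => ?_)
    fun n => ?_) bot_le
  · exact ⟨0, univ, univ_mem, (LipschitzWith.const c).lipschitzOnWith⟩
  · simp
  · simp [lipConst_eq_zero_of_eventuallyEq]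

theorem tv_univ_comp_le {μ : Measure Y} {f : Y → ℝ} (hf : tv μ f univ ≠ ⊤)
    {φ : ℝ → ℝ} {C : ℝ≥0} (hφ : LipschitzWith C φ) :
    tv μ (fun x => φ (f x)) univ ≤ C * tv μ f univ := by
  have key (a : ℝ≥0∞) (ha : tv μ f univ < a) : tv μ (fun x => φ (f x)) univ ≤ C * a := by
    obtain ⟨u, hu, hlim, hua⟩ := exists_seq_of_tv_univ_lt ha
    refine tv_univ_le (fun n => (hu n).comp_lipschitz hφ) (fun K hK hKu => ?_) fun n => ?_
    · have h0 := ENNReal.Tendsto.const_mul (a := (C : ℝ≥0∞)) (hlim K hK hKu)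
        (Or.inr ENNReal.coe_ne_top)
      rw [mul_zero] at h0
      refine tendsto_of_tendsto_of_tendsto_of_le_of_le tendsto_const_nhds h0
        (fun _ => bot_le) fun n => ?_
      refine le_trans (lintegral_mono fun x => ?_)
        (lintegral_const_mul' _ _ ENNReal.coe_ne_top).le
      rw [← ENNReal.ofReal_coe_nnreal, ← ENNReal.ofReal_mul C.coe_nonneg]
      refine ENNReal.ofReal_le_ofReal ?_
      simpa [Real.dist_eq] using hφ.dist_le_mul (u n x) (f x)
    · calc ∫⁻ x, lipConst (fun x => φ (u n x)) x ∂μ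
          ≤ ∫⁻ x, C * lipConst (u n) x ∂μ := lintegral_mono fun x => lipConst_comp_le _ hφ x
        _ = C * ∫⁻ x, lipConst (u n) x ∂μ := lintegral_const_mul' _ _ ENNReal.coe_ne_top
        _ ≤ C * a := by gcongr; exact (hua n).le
  refine ENNReal.le_of_forall_pos_le_add fun ε hε _ => ?_
  rcases eq_or_ne C 0 with rfl | hC
  · simpa using (key ⊤ hf.lt_top).trans (by simp)
  · have hpos : (ε / C : ℝ≥0) ≠ 0 := (div_pos hε (pos_iff_ne_zero.2 hC)).ne'
    refine (key _ (ENNReal.lt_add_right hf (ENNReal.coe_ne_zero.2 hpos))).trans ?_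
    rw [mul_add, ← ENNReal.coe_mul, mul_div_cancel₀ _ hC]

variable [BorelSpace Y]

theorem tv_univ_add_le {μ : Measure Y} {f g : Y → ℝ} (hf : AEMeasurable f μ) :
    tv μ (fun x => f x + g x) univ ≤ tv μ f univ + tv μ g univ := by
  rcases eq_or_ne (tv μ f univ) ⊤ with htf | htf
  · simp [htf]
  rcases eq_or_ne (tv μ g univ) ⊤ with htg | htg
  · simp [htg]
  refine ENNReal.le_of_forall_pos_le_add fun ε hε _ => ?_
  have hε' : (ε / 2 : ℝ≥0∞) ≠ 0 := by simp [hε.ne']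
  obtain ⟨u, hu, hulim, hua⟩ := exists_seq_of_tv_univ_lt (ENNReal.lt_add_right htf hε')
  obtain ⟨v, hv, hvlim, hva⟩ := exists_seq_of_tv_univ_lt (ENNReal.lt_add_right htg hε')
  refine tv_univ_le (fun n => (hu n).add (hv n)) (fun K hK hKu => ?_) fun n => ?_
  · have h0 := (hulim K hK hKu).add (hvlim K hK hKu)
    rw [add_zero] at h0
    refine tendsto_of_tendsto_of_tendsto_of_le_of_le tendsto_const_nhds h0
      (fun _ => bot_le) fun n => ?_
    beta_reduce
    rw [← lintegral_add_left']
    · refine lintegral_mono fun x => ?_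
      rw [← ENNReal.ofReal_add (abs_nonneg _) (abs_nonneg _)]
      refine ENNReal.ofReal_le_ofReal ?_
      calc |u n x + v n x - (f x + g x)| = |(u n x - f x) + (v n x - g x)| := by ring_nf
        _ ≤ _ := abs_add_le _ _
    · have := (hu n).continuous.measurable.aemeasurable (μ := μ)
      exact (this.sub hf).abs.ennreal_ofReal.restrict
  · calc ∫⁻ x, lipConst (fun x => u n x + v n x) x ∂μ
        ≤ ∫⁻ x, (lipConst (u n) x + lipConst (v n) x) ∂μ :=
          lintegral_mono fun x => lipConst_add_le _ _ x
      _ = ∫⁻ x, lipConst (u n) x ∂μ + ∫⁻ x, lipConst (v n) x ∂μ :=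
          lintegral_add_left (measurable_lipConst (hu n).continuous) _
      _ ≤ (tv μ f univ + ε / 2) + (tv μ g univ + ε / 2) := add_le_add (hua n).le (hva n).le
      _ = tv μ f univ + tv μ g univ + (ε / 2 + ε / 2) := by ring
      _ = _ := by rw [ENNReal.add_halves]

theorem tv_univ_sum_le {μ : Measure Y} {ι : Type*} (s : Finset ι) {f : ι → Y → ℝ}
    (hf : ∀ i, AEMeasurable (f i) μ) :
    tv μ (fun x => ∑ i ∈ s, f i x) univ ≤ ∑ i ∈ s, tv μ (f i) univ := by
  classical
  induction s using Finset.induction_on with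
  | empty => simp [tv_univ_const]
  | insert i s hi ih =>
    simp only [Finset.sum_insert hi]
    exact (tv_univ_add_le (hf i)).trans (by gcongr)

end TotalVariation

section Coarea

variable {Y : Type*} [MetricSpace Y]

/-- The piecewise linear transition from `0` to `1` between the levels `t` and `t + h`. -/
noncomputable def ramp (t h s : ℝ) : ℝ := max 0 (min 1 ((s - t) / h))

theorem ramp_of_le {t h s : ℝ} (hh : 0 < h) (hs : s ≤ t) : ramp t h s = 0 := by
  have : (s - t) / h ≤ 0 := div_nonpos_of_nonpos_of_nonneg (by linarith) hh.le
  rw [ramp, max_eq_left (min_le_of_right_le this)]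

theorem ramp_of_ge {t h s : ℝ} (hh : 0 < h) (hs : t + h ≤ s) : ramp t h s = 1 := by
  have : 1 ≤ (s - t) / h := by rw [le_div_iff₀ hh]; linarith
  rw [ramp, min_eq_left this, max_eq_right zero_le_one]

theorem ramp_nonneg (t h s : ℝ) : 0 ≤ ramp t h s := le_max_left _ _

theorem ramp_le_one (t h s : ℝ) : ramp t h s ≤ 1 :=
  max_le zero_le_one (min_le_left _ _)

theorem lipschitzWith_ramp (t : ℝ) {h : ℝ} (hh : 0 < h) :
    LipschitzWith (Real.toNNReal h⁻¹) (ramp t h) := by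
  have h1 : LipschitzWith (Real.toNNReal h⁻¹) fun s : ℝ => (s - t) / h := by
    refine LipschitzWith.of_dist_le_mul fun a b => ?_
    rw [Real.coe_toNNReal _ (inv_nonneg.2 hh.le), Real.dist_eq, Real.dist_eq, ← sub_div,
      abs_div, abs_of_pos hh, div_eq_inv_mul]
    simp
  exact (h1.const_min 1).const_max 0

theorem lipConst_ramp_le {u : Y → ℝ} (hu : Continuous u) (t : ℝ) {h : ℝ} (hh : 0 < h) (x : Y) :
    lipConst (fun y => ramp t h (u y)) x ≤
      (Icc (u x - h) (u x)).indicator (fun _ => ENNReal.ofReal h⁻¹ * lipConst u x) t := by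
  by_cases ht : t ∈ Icc (u x - h) (u x)
  · rw [indicator_of_mem ht]
    exact lipConst_comp_le u (lipschitzWith_ramp t hh) x
  · rw [indicator_of_notMem ht, nonpos_iff_eq_zero]
    refine lipConst_eq_zero_of_eventuallyEq ?_
    rw [mem_Icc, not_and_or, not_le, not_le] at ht
    rcases ht with ht | ht
    · filter_upwards [hu.continuousAt.eventually (lt_mem_nhds (show t + h < u x by linarith))]
        with y hy
      rw [ramp_of_ge hh hy.le, ramp_of_ge hh (by linarith)]
    · filter_upwards [hu.continuousAt.eventually (gt_mem_nhds ht)] with y hy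
      rw [ramp_of_le hh hy.le, ramp_of_le hh ht.le]

theorem lintegral_ramp_sub_le (a b : ℝ) {h : ℝ} (hh : 0 < h) :
    ∫⁻ t : ℝ, ENNReal.ofReal |ramp t h a - (Ioi t).indicator (fun _ => (1 : ℝ)) b| ≤
      ENNReal.ofReal |a - b| + ENNReal.ofReal h := by
  calc _ ≤ ∫⁻ t : ℝ, (Icc (min (a - h) b) (max a b)).indicator (fun _ => (1 : ℝ≥0∞)) t := by
        refine lintegral_mono fun t => ?_
        by_cases ht : t ∈ Icc (min (a - h) b) (max a b)
        · rw [indicator_of_mem ht]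
          refine ENNReal.ofReal_le_one.2 ?_
          have h0 := ramp_nonneg t h a
          have h1 := ramp_le_one t h a
          by_cases hb : b ∈ Ioi t
          · rw [indicator_of_mem hb, abs_le]
            constructor <;> linarith
          · rw [indicator_of_notMem hb, abs_le]
            constructor <;> linarith
        · rw [indicator_of_notMem ht]
          rw [mem_Icc, not_and_or, not_le, not_le, lt_min_iff, max_lt_iff] at ht
          rcases ht with ⟨h1, h2⟩ | ⟨h1, h2⟩
          · rw [ramp_of_ge hh (by linarith), indicator_of_mem (mem_Ioi.2 h2)]
            simp
          · rw [ramp_of_le hh h1.le, indicator_of_notMem (notMem_Ioi.2 h2.le)]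
            simp
    _ = ENNReal.ofReal (max a b - min (a - h) b) := by
        rw [lintegral_indicator_const measurableSet_Icc, Real.volume_Icc, one_mul]
    _ ≤ ENNReal.ofReal (|a - b| + h) := by
        refine ENNReal.ofReal_le_ofReal ?_
        have := le_abs_self (a - b)
        have := neg_abs_le (a - b)
        have := abs_nonneg (a - b)
        rcases max_cases a b with ⟨h1, _⟩ | ⟨h1, _⟩ <;>
          rcases min_cases (a - h) b with ⟨h2, _⟩ | ⟨h2, _⟩ <;> rw [h1, h2] <;> linarith
    _ = _ := ENNReal.ofReal_add (abs_nonneg _) hh.le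


variable [MeasurableSpace Y] [BorelSpace Y]

/-- A function of `t`, measurable by Tonelli, dominating the slope integral of the ramps of `u`
between the levels `t` and `t + h`. -/
noncomputable def levelSlope (μ : Measure Y) (u : Y → ℝ) (h t : ℝ) : ℝ≥0∞ :=
  ∫⁻ x, (Icc (u x - h) (u x)).indicator (fun _ => ENNReal.ofReal h⁻¹ * lipConst u x) t ∂μ

theorem measurable_levelSlope_integrand {u : Y → ℝ} (hu : Continuous u) (h : ℝ) :
    Measurable fun p : ℝ × Y =>
      (Icc (u p.2 - h) (u p.2)).indicator
        (fun _ => ENNReal.ofReal h⁻¹ * lipConst u p.2) p.1 := by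
  have hum : Measurable fun p : ℝ × Y => u p.2 := hu.measurable.comp measurable_snd
  have hs : MeasurableSet {p : ℝ × Y | u p.2 - h ≤ p.1 ∧ p.1 ≤ u p.2} :=
    (measurableSet_le (hum.sub_const h) measurable_fst).inter
      (measurableSet_le measurable_fst hum)
  have hl : Measurable fun p : ℝ × Y => ENNReal.ofReal h⁻¹ * lipConst u p.2 :=
    ((measurable_lipConst hu).comp measurable_snd).const_mul _
  exact hl.indicator hs

theorem measurable_levelSlope (μ : Measure Y) [SFinite μ] {u : Y → ℝ} (hu : Continuous u)
    (h : ℝ) : Measurable (levelSlope μ u h) :=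
  (measurable_levelSlope_integrand hu h).lintegral_prod_right'

theorem lintegral_levelSlope (μ : Measure Y) [SFinite μ] {u : Y → ℝ} (hu : Continuous u)
    {h : ℝ} (hh : 0 < h) : ∫⁻ t, levelSlope μ u h t = ∫⁻ x, lipConst u x ∂μ := by
  unfold levelSlope
  rw [lintegral_lintegral_swap (measurable_levelSlope_integrand hu h).aemeasurable]
  refine lintegral_congr fun x => ?_
  rw [lintegral_indicator_const measurableSet_Icc, Real.volume_Icc, sub_sub_cancel, mul_right_comm,
    ← ENNReal.ofReal_mul (inv_nonneg.2 hh.le), inv_mul_cancel₀ hh.ne', ENNReal.ofReal_one, one_mul]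

theorem measurable_ramp_sub_indicator {Z : Type*} [MeasurableSpace Z] {u f : Z → ℝ}
    (hu : Measurable u) (hf : Measurable f) (h : ℝ) :
    Measurable fun p : ℝ × Z => ENNReal.ofReal
      |ramp p.1 h (u p.2) - (Ioi p.1).indicator (fun _ => (1 : ℝ)) (f p.2)| := by
  have hs : MeasurableSet {p : ℝ × Z | p.1 < f p.2} :=
    measurableSet_lt measurable_fst (hf.comp measurable_snd)
  have h1 : Measurable fun p : ℝ × Z => (Ioi p.1).indicator (fun _ => (1 : ℝ)) (f p.2) :=
    (measurable_const (a := (1 : ℝ))).indicator hs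
  have h2 : Measurable fun p : ℝ × Z => ramp p.1 h (u p.2) := by
    unfold ramp
    fun_prop
  exact (h2.sub h1).abs.ennreal_ofReal

theorem lintegral_lintegral_ramp_sub_le {Z : Type*} [MeasurableSpace Z] (μ : Measure Z)
    [SFinite μ] {u f : Z → ℝ} (hu : Measurable u) (hf : Measurable f) {h : ℝ} (hh : 0 < h) :
    ∫⁻ t : ℝ, ∫⁻ x, ENNReal.ofReal
        |ramp t h (u x) - (Ioi t).indicator (fun _ => (1 : ℝ)) (f x)| ∂μ ≤
      ∫⁻ x, ENNReal.ofReal |u x - f x| ∂μ + ENNReal.ofReal h * μ univ := by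
  rw [lintegral_lintegral_swap (measurable_ramp_sub_indicator hu hf h).aemeasurable,
    ← lintegral_const, ← lintegral_add_right _ measurable_const]
  exact lintegral_mono fun x => lintegral_ramp_sub_le _ _ hh

variable [ProperSpace Y]

theorem exists_coarea_bound_of_lt {μ : Measure Y} [IsLocallyFiniteMeasure μ] (x₀ : Y)
    {f : Y → ℝ} (hf : Measurable f) {a : ℝ≥0∞} (ha : tv μ f univ < a) :
    ∃ G : ℝ → ℝ≥0∞, Measurable G ∧ ∫⁻ t, G t ≤ a ∧
      ∀ᵐ t, perim μ {x | t < f x} univ ≤ G t := by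
  obtain ⟨u, hu, hlim, hua⟩ := exists_seq_of_tv_univ_lt ha
  have hpow (k : ℕ) : (0 : ℝ≥0∞) < 2⁻¹ ^ k := ENNReal.pow_pos (by simp) k
  obtain ⟨φ, -, hφ⟩ := extraction_forall_of_eventually fun k : ℕ =>
    (hlim (closedBall x₀ k) (isCompact_closedBall _ _) (subset_univ _)).eventually
      (gt_mem_nhds (hpow k))
  have hwc (k : ℕ) : Continuous (u (φ k)) := (hu _).continuous
  have hfin (k : ℕ) : μ (closedBall x₀ k) ≠ ⊤ := measure_closedBall_lt_top.ne
  have hexists (k : ℕ) : ∃ h : ℝ, 0 < h ∧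
      ENNReal.ofReal h * μ (closedBall x₀ k) ≤ 2⁻¹ ^ k := by
    refine ⟨2⁻¹ ^ k / (1 + (μ (closedBall x₀ k)).toReal), by positivity, ?_⟩
    rw [← ENNReal.ofReal_toReal (hfin k), ← ENNReal.ofReal_mul (by positivity)]
    refine ENNReal.ofReal_le_of_le_toReal ?_
    rw [ENNReal.toReal_ofReal (by positivity), ENNReal.toReal_pow, ENNReal.toReal_inv,
      ENNReal.toReal_ofNat, div_mul_eq_mul_div, div_le_iff₀ (by positivity)]
    exact mul_le_mul_of_nonneg_left (by linarith) (by positivity)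
  choose h hpos hsmall using hexists
  refine ⟨fun t => liminf (fun k => levelSlope μ (u (φ k)) (h k) t) atTop,
    Measurable.liminf fun k => measurable_levelSlope μ (hwc k) _, ?_, ?_⟩
  · refine (lintegral_liminf_le fun k => measurable_levelSlope μ (hwc k) _).trans ?_
    simp only [lintegral_levelSlope μ (hwc _) (hpos _)]
    refine liminf_le_of_le (by isBoundedDefault) fun _ hb => ?_
    obtain ⟨n, hn⟩ := hb.exists
    exact hn.trans (hua _).le
  · have hmeas (k : ℕ) : Measurable fun t => ∫⁻ x in closedBall x₀ k, ENNReal.ofReal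
        |ramp t (h k) (u (φ k) x) - (Ioi t).indicator (fun _ => (1 : ℝ)) (f x)| ∂μ :=
      (measurable_ramp_sub_indicator (hwc k).measurable hf _).lintegral_prod_right'
    have hsum : ∫⁻ t, ∑' k : ℕ, ∫⁻ x in closedBall x₀ k, ENNReal.ofReal
        |ramp t (h k) (u (φ k) x) - (Ioi t).indicator (fun _ => (1 : ℝ)) (f x)| ∂μ ≠ ⊤ := by
      rw [lintegral_tsum fun k => (hmeas k).aemeasurable]
      refine ne_top_of_le_ne_top (b := ∑' k : ℕ, ((2⁻¹ : ℝ≥0∞) ^ k + 2⁻¹ ^ k)) ?_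
        (ENNReal.tsum_le_tsum fun k => ?_)
      · rw [ENNReal.tsum_add, ENNReal.tsum_geometric, ENNReal.one_sub_inv_two, inv_inv]
        simp
      · refine (lintegral_lintegral_ramp_sub_le _ (hwc k).measurable hf (hpos k)).trans ?_
        rw [Measure.restrict_apply_univ]
        exact add_le_add (hφ k).le (hsmall k)
    filter_upwards [ae_lt_top (Measurable.tsum hmeas) hsum] with t ht
    have h0 := ENNReal.tendsto_atTop_zero_of_tsum_ne_top ht.ne
    refine (tv_univ_le_liminf (u := fun k x => ramp t (h k) (u (φ k) x))
      (fun k => (hu _).comp_lipschitz (lipschitzWith_ramp t (hpos k))) ?_).trans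
      (liminf_le_liminf (Eventually.of_forall fun k =>
        lintegral_mono fun x => lipConst_ramp_le (hwc k) t (hpos k) x))
    intro K hK _
    obtain ⟨R, hR⟩ := hK.isBounded.subset_closedBall x₀
    refine tendsto_of_tendsto_of_tendsto_of_le_of_le' tendsto_const_nhds h0
      (Eventually.of_forall fun _ => bot_le) ?_
    filter_upwards [eventually_ge_atTop ⌈R⌉₊] with k hk
    exact lintegral_mono_set (hR.trans (closedBall_subset_closedBall (Nat.ceil_le.1 hk)))

/-- Coarea inequality, with a measurable majorant of the perimeters of the superlevel sets. -/
theorem exists_coarea_bound {μ : Measure Y} [IsLocallyFiniteMeasure μ] (x₀ : Y)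
    {f : Y → ℝ} (hf : Measurable f) (hfin : tv μ f univ ≠ ⊤) :
    ∃ G : ℝ → ℝ≥0∞, Measurable G ∧ ∫⁻ t, G t ≤ tv μ f univ ∧
      ∀ᵐ t, perim μ {x | t < f x} univ ≤ G t := by
  have hn (n : ℕ) : tv μ f univ < tv μ f univ + (n : ℝ≥0∞)⁻¹ :=
    ENNReal.lt_add_right hfin (by simp)
  choose G hG hle hper using fun n => exists_coarea_bound_of_lt x₀ hf (hn n)
  refine ⟨fun t => ⨅ n, G n t, Measurable.iInf hG, ?_, ?_⟩
  · have hlim : Tendsto (fun n : ℕ => tv μ f univ + (n : ℝ≥0∞)⁻¹) atTop (𝓝 (tv μ f univ)) := by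
      simpa using tendsto_const_nhds.add ENNReal.tendsto_inv_nat_nhds_zero
    exact ge_of_tendsto' hlim fun n => (lintegral_mono fun t => iInf_le _ n).trans (hle n)
  · filter_upwards [ae_all_iff.2 hper] with t ht
    exact le_iInf ht

end Coarea

section Staircase

/-- The sum of the jumps of size `δ` at the levels `t + i δ`, `-N ≤ i < N`, normalized to vanish
at `0` when `0 < t < δ`. -/
noncomputable def staircase (δ t : ℝ) (N : ℕ) (y : ℝ) : ℝ :=
  ∑ i ∈ Finset.Ico (-(N : ℤ)) N,
    (δ * (Ioi (t + i * δ)).indicator (fun _ => (1 : ℝ)) y - if i < 0 then δ else 0)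

theorem staircase_eq {δ : ℝ} (hδ : 0 < δ) (t : ℝ) (N : ℕ) (y : ℝ) :
    staircase δ t N y = δ * (max (-(N : ℤ)) (min N ⌈(y - t) / δ⌉) : ℤ) := by
  have hcount (m : ℤ) : ∑ i ∈ Finset.Ico (-(N : ℤ)) N, (if i < m then δ else 0) =
      δ * (max (-(N : ℤ)) (min N m) + N : ℤ) := by
    rw [← Finset.sum_filter, Finset.sum_const]
    have : (Finset.Ico (-(N : ℤ)) N).filter (· < m) = Finset.Ico (-(N : ℤ)) (min N m) := by
      ext i
      simp only [Finset.mem_filter, Finset.mem_Ico, lt_min_iff]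
      tauto
    rw [this, Int.card_Ico, nsmul_eq_mul, mul_comm]
    congr 1
    have : ((min (N : ℤ) m - -(N : ℤ)).toNat : ℤ) = max (-(N : ℤ)) (min N m) + N := by omega
    exact_mod_cast this
  have hterm (i : ℤ) : δ * (Ioi (t + i * δ)).indicator (fun _ => (1 : ℝ)) y =
      if i < ⌈(y - t) / δ⌉ then δ else 0 := by
    have : y ∈ Ioi (t + i * δ) ↔ i < ⌈(y - t) / δ⌉ := by
      rw [Int.lt_ceil, lt_div_iff₀ hδ, mem_Ioi, lt_sub_iff_add_lt']
    simp only [indicator, this]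
    split_ifs <;> simp
  simp only [staircase, Finset.sum_sub_distrib, hterm, hcount]
  rw [← mul_sub, ← Int.cast_sub]
  congr 2
  omega

theorem abs_staircase_sub_le {δ t : ℝ} (ht : t ∈ Ioo 0 δ) (N : ℕ) (y : ℝ) :
    |staircase δ t N y - y| ≤ |y| + δ := by
  have hδ : 0 < δ := ht.1.trans ht.2
  rw [staircase_eq hδ]
  have h1 := Int.le_ceil ((y - t) / δ)
  have h2 := Int.ceil_lt_add_one ((y - t) / δ)
  rw [div_le_iff₀ hδ] at h1
  rw [div_add_one hδ.ne', lt_div_iff₀ hδ] at h2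
  set m := ⌈(y - t) / δ⌉
  obtain ⟨ht0, ht1⟩ := ht
  rcases le_total 0 m with hm | hm
  · have a1 : (0 : ℝ) ≤ (max (-(N : ℤ)) (min N m) : ℤ) := by exact_mod_cast (by omega)
    have a2 : ((max (-(N : ℤ)) (min N m) : ℤ) : ℝ) ≤ m := by exact_mod_cast (by omega)
    rw [abs_le]
    constructor <;> nlinarith [le_abs_self y, neg_abs_le y]
  · have a1 : ((max (-(N : ℤ)) (min N m) : ℤ) : ℝ) ≤ 0 := by exact_mod_cast (by omega)
    have a2 : (m : ℝ) ≤ (max (-(N : ℤ)) (min N m) : ℤ) := by exact_mod_cast (by omega)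
    rw [abs_le]
    constructor <;> nlinarith [le_abs_self y, neg_abs_le y]

theorem abs_staircase_sub_le_of_le {δ t : ℝ} (ht : t ∈ Ioo 0 δ) {N : ℕ} {y : ℝ}
    (hy : |y| ≤ N * δ) : |staircase δ t N y - y| ≤ δ := by
  have hδ : 0 < δ := ht.1.trans ht.2
  rw [staircase_eq hδ]
  have h1 := Int.le_ceil ((y - t) / δ)
  have h2 := Int.ceil_lt_add_one ((y - t) / δ)
  rw [div_le_iff₀ hδ] at h1
  rw [div_add_one hδ.ne', lt_div_iff₀ hδ] at h2
  set m := ⌈(y - t) / δ⌉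
  obtain ⟨ht0, ht1⟩ := ht
  obtain ⟨hy1, hy2⟩ := abs_le.1 hy
  have hm1 : m < N + 1 := by
    have : (m : ℝ) < N + 1 := lt_of_mul_lt_mul_right (by linarith) hδ.le
    exact_mod_cast this
  have hm2 : -(N : ℤ) - 1 < m := by
    have : -(N : ℝ) - 1 < m := lt_of_mul_lt_mul_right (by linarith) hδ.le
    exact_mod_cast this
  have hm : max (-(N : ℤ)) (min N m) = m := by omega
  rw [hm, abs_le]
  constructor <;> linarith

theorem exists_offset_sum_le_lintegral {G : ℝ → ℝ≥0∞} (hG : Measurable G) {p : ℝ → Prop}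
    (hp : ∀ᵐ t, p t) {δ : ℝ} (hδ : 0 < δ) (I : Finset ℤ) :
    ∃ t ∈ Ioo 0 δ, (∀ i : ℤ, p (t + i * δ)) ∧
      ∑ i ∈ I, ENNReal.ofReal δ * G (t + i * δ) ≤ ∫⁻ t, G t := by
  have hshift (c : ℝ) : MeasurePreserving (fun t : ℝ => t + c) volume volume :=
    measurePreserving_add_right volume c
  have hp' : ∀ᵐ t ∂(volume.restrict (Ioo 0 δ)), t ∈ Ioo 0 δ ∧ ∀ i : ℤ, p (t + i * δ) :=
    (ae_restrict_mem measurableSet_Ioo).and <| ae_restrict_of_ae <| ae_all_iff.2 fun i =>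
      (hshift (i * δ)).quasiMeasurePreserving.ae hp
  have hmeas (i : ℤ) : Measurable fun t => G (t + i * δ) := hG.comp (measurable_add_const _)
  have hvol : (volume.restrict (Ioo 0 δ)) univ = ENNReal.ofReal δ := by simp
  have hne : volume.restrict (Ioo 0 δ) ≠ 0 := by
    rw [← Measure.measure_univ_ne_zero, hvol]
    simpa using hδ
  obtain ⟨t, ht, hle⟩ := exists_notMem_null_le_laverage hne
    (Finset.measurable_sum I fun i _ => hmeas i).aemeasurable (ae_iff.1 hp')
  obtain ⟨ht1, ht2⟩ := not_not.1 ht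
  refine ⟨t, ht1, ht2, ?_⟩
  rw [laverage_eq, hvol, ENNReal.le_div_iff_mul_le (by simp [hδ]) (by simp)] at hle
  rw [← Finset.mul_sum, mul_comm]
  refine hle.trans ?_
  rw [lintegral_finsetSum _ fun i _ => hmeas i]
  have hpiece (i : ℤ) : ∫⁻ t in Ioo 0 δ, G (t + i * δ) =
      ∫⁻ t in Ioo (0 + i • δ) (0 + (i + 1) • δ), G t := by
    rw [← (hshift (i * δ)).setLIntegral_comp_preimage measurableSet_Ioo hG]
    simp [add_mul]
  simp only [hpiece]
  rw [← lintegral_biUnion_finset (fun i _ j _ hij => pairwise_disjoint_Ioo_add_zsmul 0 δ hij)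
    fun _ _ => measurableSet_Ioo]
  exact setLIntegral_le_lintegral _ _

end Staircase

section Simple

variable {Y : Type*} [MetricSpace Y] [MeasurableSpace Y]

theorem SimpleBVFun.of_sum {μ : Measure Y} {ι : Type*} (s : Finset ι) {c : ι → ℝ}
    {E : ι → Set Y} (hE : ∀ i ∈ s, FinPerim μ (E i) ∧ μ (E i) < ⊤) :
    SimpleBVFun μ fun x => ∑ i ∈ s, c i * (E i).indicator (fun _ => (1 : ℝ)) x := by
  refine ⟨s.card, fun k => c (s.equivFin.symm k), fun k => E (s.equivFin.symm k),
    fun k => hE _ (s.equivFin.symm k).2, ?_⟩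
  ext x
  rw [← Finset.sum_coe_sort, ← s.equivFin.symm.sum_comp]

theorem FinPerim.compl {μ : Measure Y} {E : Set Y} (hE : FinPerim μ E) : FinPerim μ Eᶜ := by
  refine ⟨hE.1.compl, ?_⟩
  have hφ : LipschitzWith 1 fun s : ℝ => 1 - s :=
    LipschitzWith.of_dist_le_mul fun a b => by
      rw [Real.dist_eq, Real.dist_eq, NNReal.coe_one, one_mul, abs_sub_comm]
      ring_nf
      exact le_rfl
  have h := tv_univ_comp_le hE.2.ne hφ
  have heq : Eᶜ.indicator (fun _ => (1 : ℝ)) =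
      fun x => 1 - E.indicator (fun _ => (1 : ℝ)) x := by
    ext x
    by_cases hx : x ∈ E <;> simp [hx]
  rw [perim, heq]
  exact h.trans_lt (ENNReal.mul_lt_top ENNReal.coe_lt_top hE.2)

variable [BorelSpace Y] [ProperSpace Y]

theorem exists_staircase_simple {μ : Measure Y} [IsLocallyFiniteMeasure μ] (x₀ : Y)
    {f : Y → ℝ} (hf : Measurable f) (hfin : tv μ f univ ≠ ⊤) (hsupp : μ {x | f x ≠ 0} < ⊤)
    {δ : ℝ} (hδ : 0 < δ) (N : ℕ) :
    ∃ t ∈ Ioo 0 δ, SimpleBVFun μ (fun x => staircase δ t N (f x)) ∧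
      tv μ (fun x => staircase δ t N (f x)) univ ≤ tv μ f univ := by
  obtain ⟨G, hG, hGle, hper⟩ := exists_coarea_bound x₀ hf hfin
  obtain ⟨t, ht, htp, hsum⟩ :=
    exists_offset_sum_le_lintegral hG hper hδ (Finset.Ico (-(N : ℤ)) N)
  have hlt (i : ℤ) (hi : i ∈ Finset.Ico (-(N : ℤ)) N) : G (t + i * δ) < ⊤ := by
    have h1 := (Finset.single_le_sum (f := fun i : ℤ => ENNReal.ofReal δ * G (t + i * δ))
      (fun _ _ => bot_le) hi).trans (hsum.trans hGle)
    by_contra! htop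
    rw [top_le_iff.1 htop, ENNReal.mul_top (by simp [hδ]), top_le_iff] at h1
    exact hfin h1
  have hperim (i : ℤ) (hi : i ∈ Finset.Ico (-(N : ℤ)) N) :
      FinPerim μ {x | t + i * δ < f x} :=
    ⟨measurableSet_lt measurable_const hf, (htp i).trans_lt (hlt i hi)⟩
  refine ⟨t, ht, ?_, ?_⟩
  · have heq : (fun x => staircase δ t N (f x)) = fun x => ∑ i ∈ Finset.Ico (-(N : ℤ)) N,
        (if i < 0 then -δ else δ) *
          (if i < 0 then {x | t + i * δ < f x}ᶜ else {x | t + i * δ < f x}).indicator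
            (fun _ => (1 : ℝ)) x := by
      ext x
      refine Finset.sum_congr rfl fun i _ => ?_
      by_cases hi : i < 0 <;> by_cases hx : t + i * δ < f x <;> simp [hi, hx]
    rw [heq]
    refine SimpleBVFun.of_sum _ fun i hi => ?_
    by_cases hneg : i < 0
    · simp only [hneg, if_true]
      refine ⟨(hperim i hi).compl, (measure_mono fun x hx => ?_).trans_lt hsupp⟩
      have h1 : (i : ℝ) ≤ -1 := by exact_mod_cast (by omega : i ≤ -1)
      have h2 : f x ≤ t + i * δ := not_lt.1 hx
      have : f x < 0 := by nlinarith [ht.2]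
      exact this.ne
    · simp only [hneg, if_false]
      refine ⟨hperim i hi, (measure_mono fun x hx => ?_).trans_lt hsupp⟩
      have h1 : (0 : ℝ) ≤ i := by exact_mod_cast not_lt.1 hneg
      have h2 : t + i * δ < f x := hx
      have : 0 < f x := by nlinarith [ht.1]
      exact this.ne'
  · have hind (i : ℤ) : AEMeasurable (fun x =>
        δ * (Ioi (t + i * δ)).indicator (fun _ => (1 : ℝ)) (f x) - if i < 0 then δ else 0) μ :=
      ((((measurable_const.indicator measurableSet_Ioi).comp hf).const_mul δ).sub_const
        _).aemeasurable
    refine (tv_univ_sum_le _ hind).trans ((Finset.sum_le_sum fun i hi => ?_).trans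
      (hsum.trans hGle))
    have hφ : LipschitzWith (Real.toNNReal δ) fun s : ℝ => δ * s - if i < 0 then δ else 0 :=
      LipschitzWith.of_dist_le_mul fun a b => by
        rw [Real.dist_eq, Real.dist_eq, Real.coe_toNNReal _ hδ.le, sub_sub_sub_cancel_right,
          ← mul_sub, abs_mul, abs_of_pos hδ]
    exact (tv_univ_comp_le (hperim i hi).2.ne hφ).trans (mul_le_mul_right (htp i) _)

end Simple

/-- Density of simple BV functions. -/
theorem density_simple_BV
    (μ : Measure X) [IsLocallyFiniteMeasure μ] (hμ : μ ≠ 0) (hPI : IsPI μ)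
    (K : Set X) (hK : IsCompact K)
    (f : X → ℝ) (hf : BVFun μ f) (hspt : tsupport f ⊆ K) :
    ∃ fn : ℕ → X → ℝ,
      (∀ n, SimpleBVFun μ (fn n) ∧ tsupport (fn n) ⊆ K ∧
        tv μ (fn n) Set.univ ≤ tv μ f Set.univ) ∧
      Filter.Tendsto (fun n => ∫⁻ x, ENNReal.ofReal |fn n x - f x| ∂μ)
        Filter.atTop (𝓝 0) := by
  obtain ⟨C, -, -, hD, -⟩ := hPI
  have : ProperSpace X := hD.properSpace hμ
  obtain ⟨x₀⟩ : Nonempty X := by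
    by_contra hX
    rw [not_nonempty_iff] at hX
    exact hμ (Measure.eq_zero_of_isEmpty μ)
  obtain ⟨g, hgm, hgK, hfg⟩ : ∃ g : X → ℝ, Measurable g ∧ (∀ x, x ∉ K → g x = 0) ∧ f =ᵐ[μ] g := by
    refine ⟨K.indicator (hf.1.aestronglyMeasurable.aemeasurable.mk f),
      (AEMeasurable.measurable_mk _).indicator hK.measurableSet,
      fun x hx => indicator_of_notMem hx _, ?_⟩
    filter_upwards [hf.1.aestronglyMeasurable.aemeasurable.ae_eq_mk] with x hx
    by_cases hxK : x ∈ K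
    · rw [indicator_of_mem hxK, hx]
    · rw [indicator_of_notMem hxK, image_eq_zero_of_notMem_tsupport fun h => hxK (hspt h)]
  have htv : tv μ f univ = tv μ g univ := tv_univ_congr_ae hfg
  have hsub : {x | g x ≠ 0} ⊆ K := fun x hx => by
    by_contra hxK
    exact hx (hgK x hxK)
  have hδ (n : ℕ) : (0 : ℝ) < 1 / (n + 1) := by positivity
  choose t ht hsimple htvle using fun n : ℕ => exists_staircase_simple x₀ hgm
    (htv ▸ hf.2.ne) ((measure_mono hsub).trans_lt hK.measure_lt_top) (hδ n) ((n + 1) ^ 2)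
  have hzero (n : ℕ) (x : X) (hx : x ∉ K) :
      staircase (1 / (n + 1)) (t n) ((n + 1) ^ 2) (g x) = 0 := by
    rw [hgK x hx]
    refine Finset.sum_eq_zero fun i _ => ?_
    obtain ⟨ht0, ht1⟩ := ht n
    have hpos := hδ n
    by_cases hi : i < 0
    · have h1 : (i : ℝ) ≤ -1 := by exact_mod_cast (by omega : i ≤ -1)
      rw [indicator_of_mem (mem_Ioi.2 (by nlinarith)), if_pos hi, mul_one, sub_self]
    · have h1 : (0 : ℝ) ≤ i := by exact_mod_cast not_lt.1 hi
      rw [indicator_of_notMem (notMem_Ioi.2 (by nlinarith)), if_neg hi, mul_zero, sub_self]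
  refine ⟨fun n x => staircase (1 / (n + 1)) (t n) ((n + 1) ^ 2) (g x),
    fun n => ⟨hsimple n, ?_, htv ▸ htvle n⟩, ?_⟩
  · refine closure_minimal (fun x hx => ?_) hK.isClosed
    by_contra hxK
    exact hx (hzero n x hxK)
  · have hcongr (n : ℕ) : ∫⁻ x, ENNReal.ofReal
          |staircase (1 / (n + 1)) (t n) ((n + 1) ^ 2) (g x) - f x| ∂μ =
        ∫⁻ x, ENNReal.ofReal
          |staircase (1 / (n + 1)) (t n) ((n + 1) ^ 2) (g x) - g x| ∂μ :=
      lintegral_congr_ae (hfg.mono fun x hx => by simp only [hx])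
    simp only [hcongr]
    rw [← lintegral_zero (μ := μ)]
    refine tendsto_lintegral_of_dominated_convergence
      (K.indicator fun x => ENNReal.ofReal |g x| + 1) (fun n => ?_)
      (fun n => Eventually.of_forall fun x => ?_) ?_ (Eventually.of_forall fun x => ?_)
    · have hs : Measurable fun x => staircase (1 / (n + 1)) (t n) ((n + 1) ^ 2) (g x) := by
        unfold staircase
        exact Finset.measurable_sum _ fun i _ =>
          (((measurable_const.indicator measurableSet_Ioi).comp hgm).const_mul _).sub_const _
      exact (hs.sub hgm).abs.ennreal_ofReal
    · by_cases hxK : x ∈ K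
      · rw [indicator_of_mem hxK, ← ENNReal.ofReal_one,
          ← ENNReal.ofReal_add (abs_nonneg _) zero_le_one]
        refine ENNReal.ofReal_le_ofReal ((abs_staircase_sub_le (ht n) _ _).trans ?_)
        have : 1 / ((n : ℝ) + 1) ≤ 1 := by
          rw [div_le_one (by positivity)]
          linarith [(Nat.cast_nonneg n : (0 : ℝ) ≤ n)]
        linarith
      · beta_reduce
        rw [hzero n x hxK, hgK x hxK]
        simp
    · rw [lintegral_indicator hK.measurableSet, lintegral_add_right _ measurable_const]
      refine ENNReal.add_ne_top.2 ⟨?_, by simpa using hK.measure_lt_top.ne⟩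
      refine ne_top_of_le_ne_top ?_ (setLIntegral_le_lintegral _ _)
      exact ((hasFiniteIntegral_iff_norm g).1 (hf.1.congr hfg).2).ne
    · have hlim : Tendsto (fun n : ℕ => ENNReal.ofReal (1 / (n + 1))) atTop (𝓝 0) := by
        simpa using ENNReal.tendsto_ofReal (tendsto_one_div_add_atTop_nhds_zero_nat (𝕜 := ℝ))
      refine tendsto_of_tendsto_of_tendsto_of_le_of_le' tendsto_const_nhds hlim
        (Eventually.of_forall fun _ => bot_le) ?_
      filter_upwards [eventually_ge_atTop ⌈|g x|⌉₊] with n hn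
      refine ENNReal.ofReal_le_ofReal (abs_staircase_sub_le_of_le (ht n) ?_)
      have h1 : |g x| ≤ n := Nat.ceil_le.1 hn
      push_cast
      rw [mul_one_div, sq, mul_self_div_self]
      linarith

end PaperBV
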